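/- For all x ∈ ℝ and all q₁, q₂ ∈ (0,1) with q₁ < q₂, one has μ_{q₂}(x) − μ_{q₁}(x) < (σ/ρ)·(Φ⁻¹(q₂) − Φ⁻¹(q₁)). -/

import Mathlib

open MeasureTheory ProbabilityTheory Set Filter Topology

noncomputable def stdphi (x : ℝ) : ℝ := Real.exp (-(x ^ 2) / 2) / Real.sqrt (2 * Real.pi)

noncomputable def stdPhi (x : ℝ) : ℝ := ∫ t in Iic x, stdphi t

noncomputable def stdPhiInv : ℝ → ℝ := Function.invFun stdPhi

noncomputable def stdPhiE (c : EReal) (x s : ℝ) : ℝ :=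
  if c = ⊤ then 1 else if c = ⊥ then 0 else stdPhi ((c.toReal - x) / s)

def truncOrdered {k : ℕ} (a b : Fin k → EReal) : Prop :=
  (∀ i, a i < b i) ∧ ∀ i j : Fin k, i < j → b i < a j

def truncSet {k : ℕ} (a b : Fin k → EReal) : Set ℝ :=
  {x : ℝ | ∃ i, a i < (x : EReal) ∧ (x : EReal) < b i}

noncomputable def truncSum {k : ℕ} (a b : Fin k → EReal) (s x : ℝ) : ℝ :=
  ∑ i, (stdPhiE (b i) x s - stdPhiE (a i) x s)

noncomputable def condPDF {k : ℕ} (a b : Fin k → EReal) (σ τ μ x : ℝ) : ℝ :=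
  (1 / σ) * stdphi ((x - μ) / σ) * truncSum a b τ x
    / truncSum a b (Real.sqrt (σ ^ 2 + τ ^ 2)) μ

noncomputable def Fmu {k : ℕ} (a b : Fin k → EReal) (σ τ μ x : ℝ) : ℝ :=
  ∫ u in Iic x, condPDF a b σ τ μ u

/-- `G_μ(x,v) = Φ((x - (ρ²μ + (1-ρ²)v))/(σρ))` with `ρ² = τ²/(σ²+τ²)`. -/
noncomputable def Gfun (σ τ μ x v : ℝ) : ℝ :=
  stdPhi ((x - (τ ^ 2 / (σ ^ 2 + τ ^ 2) * μ + (1 - τ ^ 2 / (σ ^ 2 + τ ^ 2)) * v)) /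
    (σ * Real.sqrt (τ ^ 2 / (σ ^ 2 + τ ^ 2))))

/-- `G_μ(x,v)` for an extended-real `v`, with the natural conventions at `±∞`. -/
noncomputable def GfunE (σ τ μ x : ℝ) (c : EReal) : ℝ :=
  if c = ⊤ then 0 else if c = ⊥ then 1 else Gfun σ τ μ x c.toReal

/-- `h(v)` from Lemma `le_dmu_formula`. -/
noncomputable def hfun {k : ℕ} (a b : Fin k → EReal) (σ τ μ v : ℝ) : ℝ :=
  (1 / Real.sqrt (σ ^ 2 + τ ^ 2)) * stdphi ((v - μ) / Real.sqrt (σ ^ 2 + τ ^ 2)) /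
    truncSum a b (Real.sqrt (σ ^ 2 + τ ^ 2)) μ

/-- `h(v)` for an extended-real `v`, with the convention `φ(±∞) = 0`. -/
noncomputable def hfunE {k : ℕ} (a b : Fin k → EReal) (σ τ μ : ℝ) (c : EReal) : ℝ :=
  if c = ⊤ then 0 else if c = ⊥ then 0 else hfun a b σ τ μ c.toReal

/-- `l(x,v)` from Lemma `le_dens_dx`. -/
noncomputable def lfun {k : ℕ} (a b : Fin k → EReal) (τ x v : ℝ) : ℝ :=
  (1 / τ) * stdphi ((v - x) / τ) / truncSum a b τ x

/-- `l(x,v)` for an extended-real `v`, with the convention `φ(±∞) = 0`. -/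
noncomputable def lfunE {k : ℕ} (a b : Fin k → EReal) (τ x : ℝ) (c : EReal) : ℝ :=
  if c = ⊤ then 0 else if c = ⊥ then 0 else lfun a b τ x c.toReal

/-- The function `B_μ(x)` from the proof of Proposition 1. -/
noncomputable def Bfun {k : ℕ} (a b : Fin k → EReal) (σ τ μ x : ℝ) : ℝ :=
  Real.sqrt (τ ^ 2 / (σ ^ 2 + τ ^ 2)) / σ * stdphi (stdPhiInv (Fmu a b σ τ μ x))
    - condPDF a b σ τ μ x
    + ∑ i, (hfunE a b σ τ μ (b i) * (Fmu a b σ τ μ x - GfunE σ τ μ x (b i))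
        - hfunE a b σ τ μ (a i) * (Fmu a b σ τ μ x - GfunE σ τ μ x (a i)))

/-- The density of the normal distribution with mean `m` and standard deviation `s`. -/
noncomputable def normalDensity (s m v : ℝ) : ℝ := (1 / s) * stdphi ((v - m) / s)

lemma stdphi_pos (x : ℝ) : 0 < stdphi x := by
  unfold stdphi; positivity

lemma continuous_stdphi : Continuous stdphi := by
  unfold stdphi; fun_prop

lemma stdphi_eq_gaussianPDFReal : stdphi = gaussianPDFReal 0 1 := by
  ext x
  simp [stdphi, gaussianPDFReal]
  ring

lemma integrable_stdphi : Integrable stdphi := by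
  rw [stdphi_eq_gaussianPDFReal]; exact integrable_gaussianPDFReal 0 1

lemma integral_stdphi : ∫ t, stdphi t = 1 := by
  rw [stdphi_eq_gaussianPDFReal]; exact integral_gaussianPDFReal_eq_one 0 one_ne_zero

lemma stdphi_neg (x : ℝ) : stdphi (-x) = stdphi x := by
  simp [stdphi]

lemma stdPhi_sub_stdPhi (x y : ℝ) : stdPhi y - stdPhi x = ∫ t in x..y, stdphi t :=
  intervalIntegral.integral_Iic_sub_Iic integrable_stdphi.integrableOn
    integrable_stdphi.integrableOn

lemma hasDerivAt_stdPhi (x : ℝ) : HasDerivAt stdPhi (stdphi x) x := by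
  have h : stdPhi = fun y => stdPhi 0 + ∫ t in (0 : ℝ)..y, stdphi t := by
    ext y; rw [← stdPhi_sub_stdPhi]; ring
  rw [h]
  exact (intervalIntegral.integral_hasDerivAt_right
    (continuous_stdphi.intervalIntegrable _ _)
    continuous_stdphi.stronglyMeasurable.stronglyMeasurableAtFilter
    continuous_stdphi.continuousAt).const_add _

lemma continuous_stdPhi : Continuous stdPhi :=
  continuous_iff_continuousAt.2 fun x => (hasDerivAt_stdPhi x).continuousAt

lemma strictMono_stdPhi : StrictMono stdPhi :=
  strictMono_of_hasDerivAt_pos hasDerivAt_stdPhi stdphi_pos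

lemma stdPhi_nonneg (x : ℝ) : 0 ≤ stdPhi x :=
  integral_nonneg fun t => (stdphi_pos t).le

lemma stdPhi_neg (x : ℝ) : stdPhi (-x) = 1 - stdPhi x := by
  have h := integral_add_compl (measurableSet_Iic (a := x)) integrable_stdphi
  rw [integral_stdphi, compl_Iic] at h
  have h2 := integral_comp_neg_Iic (-x) stdphi
  simp only [stdphi_neg, neg_neg] at h2
  unfold stdPhi
  linarith

lemma stdPhi_le_one (x : ℝ) : stdPhi x ≤ 1 := by
  have := stdPhi_nonneg (-x)
  rw [stdPhi_neg] at this
  linarith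

lemma tendsto_stdPhi_atTop : Tendsto stdPhi atTop (𝓝 1) := by
  have h := tendsto_setIntegral_of_monotone (μ := volume) (f := stdphi)
    (s := fun x : ℝ => Iic x) (fun _ => measurableSet_Iic) (fun _ _ h => Iic_subset_Iic.2 h)
    integrable_stdphi.integrableOn
  rw [iUnion_Iic, setIntegral_univ, integral_stdphi] at h
  exact h

lemma tendsto_stdPhi_atBot : Tendsto stdPhi atBot (𝓝 0) := by
  have h : Tendsto (fun x => 1 - stdPhi (-x)) atBot (𝓝 (1 - 1)) :=
    (tendsto_stdPhi_atTop.comp tendsto_neg_atBot_atTop).const_sub 1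
  simpa [stdPhi_neg] using h

lemma stdPhi_stdPhiInv {q : ℝ} (hq : q ∈ Ioo (0 : ℝ) 1) : stdPhi (stdPhiInv q) = q := by
  obtain ⟨y, hy⟩ := mem_range_of_exists_le_of_exists_ge continuous_stdPhi
    ((tendsto_stdPhi_atBot.eventually_le_const hq.1).exists)
    ((tendsto_stdPhi_atTop.eventually_const_le hq.2).exists)
  exact Function.invFun_eq ⟨y, hy⟩

lemma normalDensity_pos {s : ℝ} (hs : 0 < s) (m v : ℝ) : 0 < normalDensity s m v :=
  mul_pos (by positivity) (stdphi_pos _)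

lemma Continuous.normalDensity {α : Type*} [TopologicalSpace α] (s : ℝ) {m v : α → ℝ}
    (hm : Continuous m) (hv : Continuous v) : Continuous fun p => normalDensity s (m p) (v p) :=
  continuous_const.mul (continuous_stdphi.comp ((hv.sub hm).div_const s))

lemma integrable_normalDensity {s : ℝ} (hs : 0 < s) (m : ℝ) : Integrable (normalDensity s m) :=
  ((integrable_stdphi.comp_div hs.ne').comp_sub_right m).const_mul (1 / s)

lemma integral_normalDensity {s : ℝ} (hs : 0 < s) (m : ℝ) : ∫ v, normalDensity s m v = 1 := by
  unfold normalDensity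
  rw [integral_const_mul, integral_sub_right_eq_self (fun v => stdphi (v / s)) m,
    Measure.integral_comp_div, integral_stdphi, abs_of_pos hs]
  simp [hs.ne']

lemma integral_Iic_normalDensity {s : ℝ} (hs : 0 < s) (m y : ℝ) :
    ∫ v in Iic y, normalDensity s m v = stdPhi ((y - m) / s) := by
  have hd (v : ℝ) : HasDerivAt (fun v => stdPhi ((v - m) / s)) (normalDensity s m v) v := by
    have := (hasDerivAt_stdPhi ((v - m) / s)).comp v (((hasDerivAt_id v).sub_const m).div_const s)
    refine this.congr_deriv ?_
    simp only [normalDensity]; ring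
  have ht : Tendsto (fun v => stdPhi ((v - m) / s)) atBot (𝓝 0) :=
    tendsto_stdPhi_atBot.comp
      ((tendsto_atBot_add_const_right atBot (-m) tendsto_id).atBot_div_const hs)
  rw [integral_Iic_of_hasDerivAt_of_tendsto (hd y).continuousAt.continuousWithinAt
    (fun v _ => hd v) (integrable_normalDensity hs m).integrableOn ht, sub_zero]

lemma setIntegral_normalDensity_eq_stdPhiE {s : ℝ} (hs : 0 < s) (m : ℝ) (c : EReal) :
    ∫ v in {v : ℝ | (v : EReal) ≤ c}, normalDensity s m v = stdPhiE c m s := by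
  induction c with
  | bot => simp [stdPhiE]
  | top => simp [stdPhiE, integral_normalDensity hs m]
  | coe y =>
    simp only [EReal.coe_le_coe_iff, stdPhiE, EReal.coe_ne_top, EReal.coe_ne_bot, if_false,
      EReal.toReal_coe]
    exact integral_Iic_normalDensity hs m y

lemma setIntegral_normalDensity_interval {s : ℝ} (hs : 0 < s) (m : ℝ) {a b : EReal} (hab : a < b) :
    ∫ v in {v : ℝ | a < v ∧ (v : EReal) ≤ b}, normalDensity s m v =
      stdPhiE b m s - stdPhiE a m s := by
  rw [← setIntegral_normalDensity_eq_stdPhiE hs, ← setIntegral_normalDensity_eq_stdPhiE hs,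
    ← setIntegral_sdiff (measurableSet_le measurable_coe_real_ereal measurable_const)
      (integrable_normalDensity hs m).integrableOn]
  · congr 2
    ext v
    simp [and_comm]
  · intro v hv
    exact le_trans hv hab.le

/-- Lebesgue measure on a union of half-open intervals, counted with multiplicity. -/
noncomputable def intervalsMeasure {k : ℕ} (a b : Fin k → EReal) : Measure ℝ :=
  ∑ i, (volume : Measure ℝ).restrict {v : ℝ | a i < v ∧ (v : EReal) ≤ b i}

instance {k : ℕ} (a b : Fin k → EReal) : SFinite (intervalsMeasure a b) := by
  rw [intervalsMeasure, ← Measure.sum_fintype]; infer_instance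

lemma integrable_intervalsMeasure {k : ℕ} (a b : Fin k → EReal) {f : ℝ → ℝ}
    (hf : Integrable f) : Integrable f (intervalsMeasure a b) :=
  integrable_finsetSum_measure.2 fun _ _ => hf.restrict

lemma intervalsMeasure_singleton {k : ℕ} (a b : Fin k → EReal) (v : ℝ) :
    intervalsMeasure a b {v} = 0 := by
  simp [intervalsMeasure]

lemma intervalsMeasure_ne_zero {k : ℕ} (a b : Fin (k + 1) → EReal) (hab : a 0 < b 0) :
    intervalsMeasure a b ≠ 0 := by
  obtain ⟨c, hc, hcb⟩ := EReal.lt_iff_exists_real_btwn.1 hab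
  obtain ⟨d, hd, hdb⟩ := EReal.lt_iff_exists_real_btwn.1 hcb
  rw [EReal.coe_lt_coe_iff] at hd
  intro h
  have h0 : (volume : Measure ℝ).restrict {v : ℝ | a 0 < v ∧ (v : EReal) ≤ b 0} univ ≤
      intervalsMeasure a b univ := by
    simp only [intervalsMeasure, Measure.coe_finsetSum, Finset.sum_apply]
    exact Finset.single_le_sum (f := fun i => (volume : Measure ℝ).restrict
      {v : ℝ | a i < v ∧ (v : EReal) ≤ b i} univ) (fun _ _ => zero_le) (Finset.mem_univ 0)
  rw [h, Measure.restrict_apply_univ] at h0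
  have h1 : volume (Ioo c d) ≤ volume {v : ℝ | a 0 < v ∧ (v : EReal) ≤ b 0} :=
    measure_mono fun v hv => ⟨hc.trans (EReal.coe_lt_coe_iff.2 hv.1),
      ((EReal.coe_lt_coe_iff.2 hv.2).trans hdb).le⟩
  have h2 := h1.trans h0
  simp [Real.volume_Ioo] at h2
  linarith

lemma integral_intervalsMeasure_normalDensity {k : ℕ} (a b : Fin k → EReal)
    (hab : ∀ i, a i < b i) {s : ℝ} (hs : 0 < s) (m : ℝ) :
    ∫ v, normalDensity s m v ∂(intervalsMeasure a b) = truncSum a b s m := by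
  rw [intervalsMeasure, integral_finsetSum_measure
    fun _ _ => (integrable_normalDensity hs m).restrict]
  exact Finset.sum_congr rfl fun i _ => setIntegral_normalDensity_interval hs m (hab i)

/-- The joint density of `X` and `X + U` factors through the conditional law of `X`. -/
lemma normalDensity_mul_normalDensity {σ τ s : ℝ} (hσ : 0 < σ) (hτ : 0 < τ) (hs : 0 < s)
    (hs2 : s ^ 2 = σ ^ 2 + τ ^ 2) (μ u v : ℝ) :
    normalDensity σ μ u * normalDensity τ u v =
      normalDensity s μ v *
        normalDensity (σ * τ / s) ((τ ^ 2 * μ + σ ^ 2 * v) / s ^ 2) u := by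
  have hexp : -(((u - μ) / σ) ^ 2) / 2 + -(((v - u) / τ) ^ 2) / 2 = -(((v - μ) / s) ^ 2) / 2 +
      -(((u - (τ ^ 2 * μ + σ ^ 2 * v) / s ^ 2) / (σ * τ / s)) ^ 2) / 2 := by
    field_simp
    simp only [hs2]
    ring
  have h : normalDensity σ μ u * normalDensity τ u v =
      1 / (σ * τ) / Real.sqrt (2 * Real.pi) ^ 2 *
        Real.exp (-(((u - μ) / σ) ^ 2) / 2 + -(((v - u) / τ) ^ 2) / 2) := by
    rw [Real.exp_add]; simp only [normalDensity, stdphi]; field_simp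
  rw [h, hexp, Real.exp_add]
  simp only [normalDensity, stdphi]
  field_simp

lemma integrable_normalDensity_mul_stdPhi {k : ℕ} (a b : Fin k → EReal) {s : ℝ} (hs : 0 < s)
    (μ : ℝ) {w : ℝ → ℝ} (hw : Continuous w) :
    Integrable (fun v => normalDensity s μ v * stdPhi (w v)) (intervalsMeasure a b) := by
  refine integrable_intervalsMeasure a b ((integrable_normalDensity hs μ).mul_bdd (c := 1)
    (continuous_stdPhi.comp hw).aestronglyMeasurable (.of_forall fun v => ?_))
  rw [Real.norm_of_nonneg (stdPhi_nonneg _)]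
  exact stdPhi_le_one _

lemma integral_swap_normalDensity {k : ℕ} (a b : Fin k → EReal) {r s : ℝ} (hr : 0 < r)
    (hs : 0 < s) (μ x : ℝ) {m : ℝ → ℝ} (hm : Continuous m) :
    ∫ u in Iic x, ∫ v, normalDensity s μ v * normalDensity r (m v) u ∂(intervalsMeasure a b) =
      ∫ v, normalDensity s μ v * stdPhi ((x - m v) / r) ∂(intervalsMeasure a b) := by
  have h₁ : Continuous fun p : ℝ × ℝ => normalDensity s μ p.2 :=
    continuous_const.normalDensity s continuous_snd
  have h₂ : Continuous fun p : ℝ × ℝ => normalDensity r (m p.2) p.1 :=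
    (hm.comp continuous_snd).normalDensity r continuous_fst
  rw [integral_integral_swap]
  · simp only [integral_const_mul, integral_Iic_normalDensity hr]
  refine (integrable_prod_iff' (h₁.mul h₂).aestronglyMeasurable).2
    ⟨.of_forall fun v =>
      ((integrable_normalDensity hr (m v)).const_mul (normalDensity s μ v)).restrict, ?_⟩
  refine (integrable_normalDensity_mul_stdPhi a b hs μ
    (by fun_prop : Continuous fun v => (x - m v) / r)).congr (.of_forall fun v => ?_)
  simp only [Pi.mul_apply]
  rw [← integral_Iic_normalDensity hr, ← integral_const_mul]
  refine integral_congr_ae (.of_forall fun u => ?_)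
  exact (Real.norm_of_nonneg (mul_pos (normalDensity_pos hs _ _) (normalDensity_pos hr _ _)).le).symm

lemma setIntegral_normalDensity_mul_truncSum {k : ℕ} (a b : Fin k → EReal)
    (hab : ∀ i, a i < b i) {σ τ s : ℝ} (hσ : 0 < σ) (hτ : 0 < τ) (hs : 0 < s)
    (hs2 : s ^ 2 = σ ^ 2 + τ ^ 2) (μ x : ℝ) :
    ∫ u in Iic x, normalDensity σ μ u * truncSum a b τ u =
      ∫ v, normalDensity s μ v *
        stdPhi ((x - (τ ^ 2 * μ + σ ^ 2 * v) / s ^ 2) / (σ * τ / s)) ∂(intervalsMeasure a b) := by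
  rw [← integral_swap_normalDensity a b (by positivity) hs μ x
    (by fun_prop : Continuous fun v => (τ ^ 2 * μ + σ ^ 2 * v) / s ^ 2)]
  simp only [← normalDensity_mul_normalDensity hσ hτ hs hs2, integral_const_mul,
    integral_intervalsMeasure_normalDensity a b hab hτ]

lemma Fmu_eq_div {k : ℕ} (a b : Fin k → EReal) (hab : ∀ i, a i < b i) {σ τ s : ℝ} (hσ : 0 < σ)
    (hτ : 0 < τ) (hs : 0 < s) (hs2 : s ^ 2 = σ ^ 2 + τ ^ 2) (μ x : ℝ) :
    Fmu a b σ τ μ x = (∫ v, normalDensity s μ v *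
        stdPhi ((x - (τ ^ 2 * μ + σ ^ 2 * v) / s ^ 2) / (σ * τ / s)) ∂(intervalsMeasure a b)) /
      ∫ v, normalDensity s μ v ∂(intervalsMeasure a b) := by
  rw [← setIntegral_normalDensity_mul_truncSum a b hab hσ hτ hs hs2,
    integral_intervalsMeasure_normalDensity a b hab hs]
  simp only [Fmu, condPDF, ← hs2, Real.sqrt_sq hs.le, normalDensity]
  rw [integral_div]

/-- The tilted difference `e^{-dw} (Φ(w - d) - Φ(c - d))` lies strictly below its multiple of
`Φ(w) - Φ(c)` away from `w = c`. -/
lemma exp_mul_stdPhi_sub_lt {d c w : ℝ} (hd : 0 < d) (hw : w ≠ c) :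
    Real.exp (-(d * w)) * (stdPhi (w - d) - stdPhi (c - d)) <
      Real.exp (-(d ^ 2) / 2) * (stdPhi w - stdPhi c) := by
  set f : ℝ → ℝ := fun w => Real.exp (-(d ^ 2) / 2) * (stdPhi w - stdPhi c) -
    Real.exp (-(d * w)) * (stdPhi (w - d) - stdPhi (c - d)) with hf
  have hderiv (y : ℝ) : HasDerivAt f
      (d * Real.exp (-(d * y)) * (stdPhi (y - d) - stdPhi (c - d))) y := by
    have h1 := ((hasDerivAt_stdPhi y).sub_const (stdPhi c)).const_mul (Real.exp (-(d ^ 2) / 2))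
    have h2 := (((hasDerivAt_id y).const_mul d).neg).exp
    have h3 := ((hasDerivAt_stdPhi (y - d)).comp y ((hasDerivAt_id y).sub_const d)).sub_const
      (stdPhi (c - d))
    refine (h1.sub (h2.mul h3)).congr_deriv ?_
    have hkey : Real.exp (-(d * y)) * stdphi (y - d) = Real.exp (-(d ^ 2) / 2) * stdphi y := by
      simp only [stdphi, ← mul_div_assoc, ← Real.exp_add]
      ring_nf
    simp only [id, Function.comp, mul_one, Pi.neg_apply]
    linear_combination -hkey
  have hc : f c = 0 := by simp [hf]
  have hcont : Continuous f := continuous_iff_continuousAt.2 fun y => (hderiv y).continuousAt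
  have hpos : 0 < f w := by
    rw [← hc]
    rcases hw.lt_or_gt with h | h
    · refine strictAntiOn_of_deriv_neg (convex_Iic c) hcont.continuousOn (fun y hy => ?_)
        h.le self_mem_Iic h
      rw [interior_Iic] at hy
      rw [(hderiv y).deriv]
      exact mul_neg_of_pos_of_neg (by positivity)
        (sub_neg.2 (strictMono_stdPhi (sub_lt_sub_right hy d)))
    · refine strictMonoOn_of_deriv_pos (convex_Ici c) hcont.continuousOn (fun y hy => ?_)
        self_mem_Ici h.le h
      rw [interior_Ici] at hy
      rw [(hderiv y).deriv]
      exact mul_pos (by positivity)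
        (sub_pos.2 (strictMono_stdPhi (sub_lt_sub_right hy d)))
  simp only [hf] at hpos
  linarith

/-- Exponentially tilting a weight by `e^{-dw}` lowers the `Φ⁻¹`-transform of the mean of
`Φ(w - d)` by more than `d`. -/
lemma integral_tilted_stdPhi_lt {ν : Measure ℝ} (hν : ν ≠ 0) {g w : ℝ → ℝ} {d c : ℝ} (hd : 0 < d)
    (hg : ∀ v, 0 < g v) (hw : Continuous w) (hwc : ν {v | w v = c} = 0) (hgi : Integrable g ν)
    (hgi' : Integrable (fun v => g v * Real.exp (-(d * w v))) ν)
    (h : ∫ v, g v * stdPhi (w v) ∂ν = stdPhi c * ∫ v, g v ∂ν) :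
    ∫ v, g v * Real.exp (-(d * w v)) * stdPhi (w v - d) ∂ν <
      stdPhi (c - d) * ∫ v, g v * Real.exp (-(d * w v)) ∂ν := by
  have hbdd {f : ℝ → ℝ} (hf : Integrable f ν) (e : ℝ) :
      Integrable (fun v => f v * stdPhi (w v - e)) ν := by
    refine hf.mul_bdd (c := 1) (continuous_stdPhi.comp (by fun_prop)).aestronglyMeasurable
      (.of_forall fun v => ?_)
    rw [Real.norm_of_nonneg (stdPhi_nonneg _)]
    exact stdPhi_le_one _
  have hb0 : Integrable (fun v => g v * stdPhi (w v)) ν := by simpa using hbdd hgi 0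
  have hb1 := hbdd hgi' d
  set K := Real.exp (-(d ^ 2) / 2)
  have hi1 : Integrable (fun v => K * (g v * stdPhi (w v) - stdPhi c * g v)) ν :=
    (hb0.sub (hgi.const_mul _)).const_mul _
  have hi2 : Integrable (fun v => g v * Real.exp (-(d * w v)) * stdPhi (w v - d) -
      stdPhi (c - d) * (g v * Real.exp (-(d * w v)))) ν := hb1.sub (hgi'.const_mul _)
  have hlt (v : ℝ) (hv : w v ≠ c) : 0 < K * (g v * stdPhi (w v) - stdPhi c * g v) -
      (g v * Real.exp (-(d * w v)) * stdPhi (w v - d) -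
        stdPhi (c - d) * (g v * Real.exp (-(d * w v)))) := by
    have := mul_lt_mul_of_pos_left (exp_mul_stdPhi_sub_lt hd hv) (hg v)
    simp only [K]
    linarith
  have hpos : 0 < ∫ v, (K * (g v * stdPhi (w v) - stdPhi c * g v) -
      (g v * Real.exp (-(d * w v)) * stdPhi (w v - d) -
        stdPhi (c - d) * (g v * Real.exp (-(d * w v))))) ∂ν := by
    refine (integral_pos_iff_support_of_nonneg (fun v => ?_) (hi1.sub hi2)).2 ?_
    · by_cases hv : w v = c
      · simp [hv, mul_comm]
      · exact (hlt v hv).le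
    · have hsub : {v | w v = c}ᶜ ⊆ Function.support fun v =>
          K * (g v * stdPhi (w v) - stdPhi c * g v) -
          (g v * Real.exp (-(d * w v)) * stdPhi (w v - d) -
            stdPhi (c - d) * (g v * Real.exp (-(d * w v)))) := fun v hv => (hlt v hv).ne'
      refine lt_of_lt_of_le ?_ (measure_mono hsub)
      rw [measure_compl₀ (NullMeasurableSet.of_null hwc) (by simp [hwc]), hwc, tsub_zero]
      exact Measure.measure_univ_pos.2 hν
  rw [integral_sub hi1 hi2, integral_const_mul, integral_sub hb0 (hgi.const_mul _),
    integral_sub hb1 (hgi'.const_mul _), integral_const_mul, integral_const_mul, h] at hpos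
  linarith

lemma normalDensity_tilt {s : ℝ} (hs : 0 < s) (m₁ m₂ v : ℝ) :
    normalDensity s m₂ v =
      Real.exp ((m₁ ^ 2 - m₂ ^ 2) / (2 * s ^ 2)) *
        (normalDensity s m₁ v * Real.exp ((m₂ - m₁) * v / s ^ 2)) := by
  have h : -(((v - m₂) / s) ^ 2) / 2 = (m₁ ^ 2 - m₂ ^ 2) / (2 * s ^ 2) +
      (-(((v - m₁) / s) ^ 2) / 2 + (m₂ - m₁) * v / s ^ 2) := by
    field_simp; ring
  simp only [normalDensity, stdphi]
  rw [h, Real.exp_add, Real.exp_add]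
  ring

/-- If `F_{μ₁}(x) = Φ(c)` and `μ₁ < μ₂`, then `F_{μ₂}(x) < Φ(c - (ρ/σ)(μ₂ - μ₁))`, where
`ρ = τ / s`. -/
lemma Fmu_lt_stdPhi_sub {k : ℕ} (a b : Fin (k + 1) → EReal) (hab : ∀ i, a i < b i) {σ τ s : ℝ}
    (hσ : 0 < σ) (hτ : 0 < τ) (hs : 0 < s) (hs2 : s ^ 2 = σ ^ 2 + τ ^ 2) {μ₁ μ₂ x c : ℝ}
    (hμ : μ₁ < μ₂) (hc : Fmu a b σ τ μ₁ x = stdPhi c) :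
    Fmu a b σ τ μ₂ x < stdPhi (c - τ / s / σ * (μ₂ - μ₁)) := by
  have hν := intervalsMeasure_ne_zero a b (hab 0)
  have hZ (μ : ℝ) : 0 < ∫ v, normalDensity s μ v ∂(intervalsMeasure a b) := by
    refine (integral_pos_iff_support_of_nonneg (fun v => (normalDensity_pos hs μ v).le)
      (integrable_intervalsMeasure a b (integrable_normalDensity hs μ))).2 ?_
    rw [show Function.support (fun v => normalDensity s μ v) = univ from
      eq_univ_of_forall fun v => (normalDensity_pos hs μ v).ne']
    exact Measure.measure_univ_pos.2 hν
  rw [Fmu_eq_div a b hab hσ hτ hs hs2, div_eq_iff (hZ μ₁).ne'] at hc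
  rw [Fmu_eq_div a b hab hσ hτ hs hs2, div_lt_iff₀ (hZ μ₂)]
  set d := τ / s / σ * (μ₂ - μ₁) with hd
  set w : ℝ → ℝ := fun v => (x - (τ ^ 2 * μ₁ + σ ^ 2 * v) / s ^ 2) / (σ * τ / s) with hw
  have hd0 : 0 < d := mul_pos (by positivity) (sub_pos.2 hμ)
  have hshift (v : ℝ) : (x - (τ ^ 2 * μ₂ + σ ^ 2 * v) / s ^ 2) / (σ * τ / s) = w v - d := by
    simp only [hw, hd]
    field_simp
    ring
  obtain ⟨C, hC0, hC⟩ : ∃ C : ℝ, 0 < C ∧ ∀ v, normalDensity s μ₂ v =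
      C * (normalDensity s μ₁ v * Real.exp (-(d * w v))) := by
    refine ⟨Real.exp ((μ₁ ^ 2 - μ₂ ^ 2) / (2 * s ^ 2)) *
      Real.exp ((μ₂ - μ₁) / σ ^ 2 * (x - τ ^ 2 * μ₁ / s ^ 2)), by positivity, fun v => ?_⟩
    have : (μ₂ - μ₁) * v / s ^ 2 =
        (μ₂ - μ₁) / σ ^ 2 * (x - τ ^ 2 * μ₁ / s ^ 2) + -(d * w v) := by
      simp only [hw, hd]
      field_simp
      ring
    rw [normalDensity_tilt hs μ₁ μ₂ v, this, Real.exp_add]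
    ring
  have hgi' : Integrable (fun v => normalDensity s μ₁ v * Real.exp (-(d * w v)))
      (intervalsMeasure a b) := by
    have := (integrable_intervalsMeasure a b (integrable_normalDensity hs μ₂)).const_mul C⁻¹
    simpa [hC, hC0.ne'] using this
  have hwc : intervalsMeasure a b {v | w v = c} = 0 := by
    refine measure_mono_null (t := {(s ^ 2 * (x - c * (σ * τ / s)) - τ ^ 2 * μ₁) / σ ^ 2})
      (fun v hv => ?_) (intervalsMeasure_singleton a b _)
    have hv' : w v = c := hv
    rw [mem_singleton_iff, ← hv']
    simp only [hw]
    field_simp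
    ring
  have hmain := integral_tilted_stdPhi_lt hν hd0 (normalDensity_pos hs μ₁)
    (by fun_prop : Continuous w) hwc
    (integrable_intervalsMeasure a b (integrable_normalDensity hs μ₁)) hgi' hc
  simp only [hshift, hC, mul_assoc, integral_const_mul] at hmain ⊢
  have := mul_lt_mul_of_pos_left hmain hC0
  linarith

/-- Theorem 1 (inequality part): the confidence interval length is bounded by
`(σ/ρ)(Φ⁻¹(q₂) - Φ⁻¹(q₁))` where `ρ² = τ²/(σ²+τ²)`. -/
theorem stmt0 {k : ℕ} (a b : Fin (k + 1) → EReal) (hab : truncOrdered a b)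
    (σ τ ρ : ℝ) (hσ : 0 < σ) (hτ : 0 < τ)
    (hρ : 0 < ρ) (hρ2 : ρ ^ 2 = τ ^ 2 / (σ ^ 2 + τ ^ 2))
    (μq : ℝ → ℝ → ℝ)
    (hμq : ∀ q ∈ Ioo (0 : ℝ) 1, ∀ x : ℝ, Fmu a b σ τ (μq q x) x = 1 - q)
    (x : ℝ) (q₁ q₂ : ℝ) (hq₁ : q₁ ∈ Ioo (0 : ℝ) 1) (hq₂ : q₂ ∈ Ioo (0 : ℝ) 1)
    (hq : q₁ < q₂) :
    μq q₂ x - μq q₁ x < σ / ρ * (stdPhiInv q₂ - stdPhiInv q₁) := by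
  have hs : 0 < Real.sqrt (σ ^ 2 + τ ^ 2) := Real.sqrt_pos.2 (by positivity)
  have hs2 : Real.sqrt (σ ^ 2 + τ ^ 2) ^ 2 = σ ^ 2 + τ ^ 2 := Real.sq_sqrt (by positivity)
  have hρs : ρ = τ / Real.sqrt (σ ^ 2 + τ ^ 2) := by
    rw [← hs2, ← div_pow] at hρ2
    exact (pow_left_inj₀ hρ.le (by positivity) two_ne_zero).1 hρ2
  have hmono : stdPhiInv q₁ < stdPhiInv q₂ := by
    rw [← strictMono_stdPhi.lt_iff_lt, stdPhi_stdPhiInv hq₁, stdPhi_stdPhiInv hq₂]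
    exact hq
  rcases le_or_gt (μq q₂ x) (μq q₁ x) with hμ | hμ
  · exact (sub_nonpos.2 hμ).trans_lt (mul_pos (by positivity) (sub_pos.2 hmono))
  have h := Fmu_lt_stdPhi_sub a b hab.1 hσ hτ hs hs2 (c := -stdPhiInv q₁) hμ
    (by rw [hμq q₁ hq₁, stdPhi_neg, stdPhi_stdPhiInv hq₁])
  rw [hμq q₂ hq₂, ← stdPhi_stdPhiInv hq₂, ← stdPhi_neg, strictMono_stdPhi.lt_iff_lt, ← hρs] at h
  rw [div_mul_eq_mul_div, lt_div_iff₀ hρ]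
  have h' : ρ / σ * (μq q₂ x - μq q₁ x) < stdPhiInv q₂ - stdPhiInv q₁ := by
    rw [stdPhi_stdPhiInv hq₂] at h
    linarith
  rw [div_mul_eq_mul_div, div_lt_iff₀ hσ] at h'
  linarith
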